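/- (Diffusion mixture representation: Fokker–Planck equation of the mixture, core of Theorem C.1 / Proposition 3.) Let T > 0, D ≥ 1, m ≥ 1, and for i = 1, …, m let p_i : (0,T) × ℝ^D → ℝ be positive functions that are differentiable in t and twice continuously differentiable in x, let f_i : (0,T) × ℝ^D → ℝ^D be continuously differentiable in x, and let g_i : (0,T) → ℝ. Suppose each p_i satisfies the Fokker–Planck equation ∂p_i/∂t (t,x) = −div_x( f_i(t,x) p_i(t,x) ) + (1/2) Δ_x( g_i(t)² p_i(t,x) ) for all (t,x). Let ω_1, …, ω_m ≥ 0 with Σ_i ω_i = 1 and ω_i > 0 for at least one i, set p_M(t,x) = Σ_i ω_i p_i(t,x), f_M(t,x) = (Σ_i ω_i p_i(t,x) f_i(t,x)) / p_M(t,x), and g_M(t,x)² = (Σ_i ω_i p_i(t,x) g_i(t)²) / p_M(t,x). Then p_M satisfies ∂p_M/∂t (t,x) = −div_x( f_M(t,x) p_M(t,x) ) + (1/2) Δ_x( g_M(t,x)² p_M(t,x) ) for all (t,x) ∈ (0,T) × ℝ^D. -/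

import Mathlib

open Finset

/-- The spatial divergence `div_x F = ∑ d, ∂F_d/∂x_d` of a vector field
`F : ℝ^D → ℝ^D`, expressed via the Fréchet derivative in the coordinate
directions. -/
noncomputable def spatialDiv {D : ℕ} (F : (Fin D → ℝ) → Fin D → ℝ)
    (x : Fin D → ℝ) : ℝ :=
  ∑ d, fderiv ℝ (fun y => F y d) x (Pi.single d 1)

/-- The spatial Laplacian `Δ_x a = ∑ d, ∂²a/∂x_d²` of a scalar field
`a : ℝ^D → ℝ`. -/
noncomputable def spatialLaplacian {D : ℕ} (a : (Fin D → ℝ) → ℝ)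
    (x : Fin D → ℝ) : ℝ :=
  ∑ d, fderiv ℝ (fun y => fderiv ℝ a y (Pi.single d 1)) x (Pi.single d 1)

/-- **Diffusion mixture representation; Theorem C.1 / Proposition 3.**
If each positive density `p i`, differentiable in `t` and `C²` in `x`, satisfies
the Fokker–Planck equation of `SDE(f i, g i)` on `(0,T) × ℝ^D` (with `f i`
`C¹` in `x`), then for any mixture weights `ω` the mixture
`p_M(t,x) = ∑ i, ω i * p i t x` satisfies the Fokker–Planck equation with drift
`f_M(t,x) = (∑ i, ω i * p i t x * f i t x) / p_M(t,x)` and squared diffusion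
coefficient `g_M(t,x)² = (∑ i, ω i * p i t x * g i t ^ 2) / p_M(t,x)`. -/
theorem diffusion_mixture_fokker_planck
    (T : ℝ) (hT : 0 < T) (D : ℕ) (hD : 1 ≤ D) (m : ℕ) (hm : 1 ≤ m)
    (p : Fin m → ℝ → (Fin D → ℝ) → ℝ)
    (f : Fin m → ℝ → (Fin D → ℝ) → Fin D → ℝ)
    (g : Fin m → ℝ → ℝ)
    (hppos : ∀ i, ∀ t ∈ Set.Ioo (0 : ℝ) T, ∀ x, 0 < p i t x)
    (hpt : ∀ i x, ∀ t ∈ Set.Ioo (0 : ℝ) T, DifferentiableAt ℝ (fun s => p i s x) t)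
    (hpx : ∀ i, ∀ t ∈ Set.Ioo (0 : ℝ) T, ContDiff ℝ 2 (p i t))
    (hfx : ∀ i, ∀ t ∈ Set.Ioo (0 : ℝ) T, ContDiff ℝ 1 (f i t))
    (hFP : ∀ i, ∀ t ∈ Set.Ioo (0 : ℝ) T, ∀ x,
      deriv (fun s => p i s x) t =
        - spatialDiv (fun y d => f i t y d * p i t y) x
          + (1 / 2) * spatialLaplacian (fun y => (g i t) ^ 2 * p i t y) x)
    (ω : Fin m → ℝ) (hω : ∀ i, 0 ≤ ω i) (hωsum : ∑ i, ω i = 1)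
    (hωpos : ∃ i, 0 < ω i) :
    ∀ t ∈ Set.Ioo (0 : ℝ) T, ∀ x,
      deriv (fun s => ∑ i, ω i * p i s x) t =
        - spatialDiv (fun y d =>
            ((∑ i, ω i * p i t y * f i t y d) / (∑ i, ω i * p i t y)) *
              (∑ i, ω i * p i t y)) x
          + (1 / 2) * spatialLaplacian (fun y =>
              ((∑ i, ω i * p i t y * (g i t) ^ 2) / (∑ i, ω i * p i t y)) *
                (∑ i, ω i * p i t y)) x := by
  intro t ht x
  have hM : ∀ y, (∑ i, ω i * p i t y) ≠ 0 := by
    intro y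
    obtain ⟨j, hj⟩ := hωpos
    refine ne_of_gt (Finset.sum_pos' (fun i _ => mul_nonneg (hω i) (hppos i t ht y).le)
      ⟨j, Finset.mem_univ j, mul_pos hj (hppos j t ht y)⟩)
  have hp1 : ∀ i, Differentiable ℝ (p i t) := fun i => (hpx i t ht).differentiable (by norm_num)
  have hf1 : ∀ i d, Differentiable ℝ (fun y => f i t y d) := fun i d =>
    differentiable_pi.1 ((hfx i t ht).differentiable (by norm_num)) d
  have hdp : ∀ i (v : Fin D → ℝ), Differentiable ℝ (fun y => fderiv ℝ (p i t) y v) := by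
    intro i v
    have h : ContDiff ℝ 1 (fderiv ℝ (p i t)) := (hpx i t ht).fderiv_right (by norm_num)
    exact (h.differentiable (by norm_num)).clm_apply (differentiable_const v)
  have hL : ∀ i, spatialLaplacian (fun y => (g i t) ^ 2 * p i t y) x
      = (g i t) ^ 2 * spatialLaplacian (p i t) x := by
    intro i
    unfold spatialLaplacian
    rw [Finset.mul_sum]
    refine Finset.sum_congr rfl fun d _ => ?_
    have e : (fun y => fderiv ℝ (fun y => (g i t) ^ 2 * p i t y) y (Pi.single d 1))
        = fun y => (g i t) ^ 2 * fderiv ℝ (p i t) y (Pi.single d 1) := by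
      funext y
      rw [fderiv_const_mul (hp1 i y)]
      rfl
    rw [e, fderiv_const_mul (hdp i _ x)]
    rfl
  have hLs : spatialLaplacian (fun y => ∑ i, ω i * p i t y * (g i t) ^ 2) x
      = ∑ i, ω i * ((g i t) ^ 2 * spatialLaplacian (p i t) x) := by
    unfold spatialLaplacian
    simp_rw [Finset.mul_sum]
    rw [Finset.sum_comm]
    refine Finset.sum_congr rfl fun d _ => ?_
    have e : (fun y => fderiv ℝ (fun y => ∑ i, ω i * p i t y * (g i t) ^ 2) y (Pi.single d 1))
        = fun y => ∑ i, (ω i * (g i t) ^ 2) * fderiv ℝ (p i t) y (Pi.single d 1) := by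
      funext y
      have : (fun y => ∑ i, ω i * p i t y * (g i t) ^ 2)
          = fun y => ∑ i, (ω i * (g i t) ^ 2) * p i t y := by
        funext y
        exact Finset.sum_congr rfl fun i _ => by ring
      rw [this, fderiv_fun_sum (fun i _ => (hp1 i y).const_mul _), ContinuousLinearMap.sum_apply]
      refine Finset.sum_congr rfl fun i _ => ?_
      rw [fderiv_const_mul (hp1 i y)]
      rfl
    rw [e, fderiv_fun_sum (fun i _ => (hdp i _ x).const_mul _), ContinuousLinearMap.sum_apply]
    refine Finset.sum_congr rfl fun i _ => ?_
    rw [fderiv_const_mul (hdp i _ x), ← mul_assoc]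
    rfl
  have hDs : spatialDiv (fun y d => ∑ i, ω i * p i t y * f i t y d) x
      = ∑ i, ω i * spatialDiv (fun y d => f i t y d * p i t y) x := by
    unfold spatialDiv
    simp_rw [Finset.mul_sum]
    rw [Finset.sum_comm]
    refine Finset.sum_congr rfl fun d _ => ?_
    have : (fun y => ∑ i, ω i * p i t y * f i t y d)
        = fun y => ∑ i, ω i * (f i t y d * p i t y) := by
      funext y
      exact Finset.sum_congr rfl fun i _ => by ring
    have hfp : ∀ i, DifferentiableAt ℝ (fun y => f i t y d * p i t y) x := fun i =>
      (hf1 i d x).mul (hp1 i x)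
    rw [this, fderiv_fun_sum (fun i _ => (hfp i).const_mul _), ContinuousLinearMap.sum_apply]
    refine Finset.sum_congr rfl fun i _ => ?_
    rw [fderiv_const_mul (hfp i)]
    rfl
  simp_rw [fun (a : ℝ) y => div_mul_cancel₀ a (hM y)]
  rw [hLs, hDs, deriv_fun_sum (fun i _ => (hpt i x t ht).const_mul _), Finset.mul_sum,
    ← Finset.sum_neg_distrib, ← Finset.sum_add_distrib]
  refine Finset.sum_congr rfl fun i _ => ?_
  rw [deriv_const_mul _ (hpt i x t ht), hFP i t ht x, hL i]
  ring
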